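/- Let b be a slowly varying function and p, q ∈ (0,∞]. Then L^{(p,q,b)} = L^{p,q,b} (as sets of μ-measurable functions) if and only if p > 1. -/

import Mathlib

open MeasureTheory Set Filter ENNReal Topology

noncomputable section

/-- `f ≈ g` on `S`: two-sided equivalence with positive constants. -/
def EquivOn (f g : ℝ → ℝ) (S : Set ℝ) : Prop :=
  ∃ c C : ℝ, 0 < c ∧ 0 < C ∧ ∀ t ∈ S, c * g t ≤ f t ∧ f t ≤ C * g t

/-- A measurable positive function on `(0,∞)` is slowly varying if for every `ε > 0`,
`t ^ ε * b t` is equivalent to a non-decreasing function and `t ^ (-ε) * b t` is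
equivalent to a non-increasing function on `(0,∞)`. -/
def IsSlowlyVarying (b : ℝ → ℝ) : Prop :=
  Measurable b ∧ (∀ t ∈ Set.Ioi (0:ℝ), 0 < b t) ∧
    ∀ ε : ℝ, 0 < ε →
      (∃ bp : ℝ → ℝ, MonotoneOn bp (Set.Ioi 0) ∧
        EquivOn (fun t => t ^ ε * b t) bp (Set.Ioi 0)) ∧
      (∃ bm : ℝ → ℝ, AntitoneOn bm (Set.Ioi 0) ∧
        EquivOn (fun t => t ^ (-ε) * b t) bm (Set.Ioi 0))

/-- The non-increasing rearrangement `f*` (with values in `ℝ≥0∞`). -/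
def rearr {X : Type*} [MeasurableSpace X] (μ : Measure X) (f : X → ℝ) (t : ℝ) : ℝ≥0∞ :=
  sInf {s : ℝ≥0∞ | μ {x | s < ENNReal.ofReal |f x|} ≤ ENNReal.ofReal t}

/-- The maximal function `f**(t) = (1/t) ∫₀ᵗ f*`. -/
def maxf {X : Type*} [MeasurableSpace X] (μ : Measure X) (f : X → ℝ) (t : ℝ) : ℝ≥0∞ :=
  (ENNReal.ofReal t)⁻¹ * ∫⁻ s in Set.Ioo (0:ℝ) t, rearr μ f s

/-- The `L^q` "norm" over a subset `S ⊆ ℝ` of an `ℝ≥0∞`-valued function. -/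
def lqNorm (q : ℝ≥0∞) (S : Set ℝ) (g : ℝ → ℝ≥0∞) : ℝ≥0∞ :=
  if q = ∞ then essSup g (volume.restrict S)
  else (∫⁻ t in S, g t ^ q.toReal) ^ (1 / q.toReal)

/-- The Lorentz–Karamata functional `‖f‖_{p,q,b}`. -/
def lkNorm {X : Type*} [MeasurableSpace X] (μ : Measure X) (p q : ℝ≥0∞) (b : ℝ → ℝ)
    (f : X → ℝ) : ℝ≥0∞ :=
  lqNorm q (Set.Ioi 0)
    (fun t => ENNReal.ofReal (t ^ (p⁻¹.toReal - q⁻¹.toReal) * b t) * rearr μ f t)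

/-- The Lorentz–Karamata functional `‖f‖_{(p,q,b)}` defined via the maximal function. -/
def lkMaxNorm {X : Type*} [MeasurableSpace X] (μ : Measure X) (p q : ℝ≥0∞) (b : ℝ → ℝ)
    (f : X → ℝ) : ℝ≥0∞ :=
  lqNorm q (Set.Ioi 0)
    (fun t => ENNReal.ofReal (t ^ (p⁻¹.toReal - q⁻¹.toReal) * b t) * maxf μ f t)

/-- The `L^q(0,∞)` norm of `t ^ (1/p - 1/q) * b t` restricted to `S`. -/
def weightNorm (p q : ℝ≥0∞) (b : ℝ → ℝ) (S : Set ℝ) : ℝ≥0∞ :=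
  lqNorm q S (fun t => ENNReal.ofReal (t ^ (p⁻¹.toReal - q⁻¹.toReal) * b t))

/-- A measure is non-atomic. -/
def IsNonatomic {X : Type*} [MeasurableSpace X] (μ : Measure X) : Prop :=
  ∀ s : Set X, MeasurableSet s → 0 < μ s →
    ∃ t, t ⊆ s ∧ MeasurableSet t ∧ 0 < μ t ∧ μ t < μ s

/-- `b̃(t) = ∫₀ᵗ s⁻¹ b(s) ds`. -/
def svTilde (b : ℝ → ℝ) (t : ℝ) : ℝ≥0∞ :=
  ∫⁻ s in Set.Ioo (0:ℝ) t, ENNReal.ofReal (s⁻¹ * b s)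

/-- `b̃_∞(t) = esssup_{s ∈ (0,t)} b(s)`. -/
def svTildeSup (b : ℝ → ℝ) (t : ℝ) : ℝ≥0∞ :=
  essSup (fun s => ENNReal.ofReal (b s)) (volume.restrict (Set.Ioo (0:ℝ) t))

/-- `b̂(t) = ∫_t^∞ s⁻¹ b(s) ds`. -/
def svHat (b : ℝ → ℝ) (t : ℝ) : ℝ≥0∞ :=
  ∫⁻ s in Set.Ioi t, ENNReal.ofReal (s⁻¹ * b s)

/-- `b̂_∞(t) = esssup_{s ∈ (t,∞)} b(s)`. -/
def svHatSup (b : ℝ → ℝ) (t : ℝ) : ℝ≥0∞ :=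
  essSup (fun s => ENNReal.ofReal (b s)) (volume.restrict (Set.Ioi t))

/-- The associate functional of a functional `N`. -/
def assocNorm {X : Type*} [MeasurableSpace X] (μ : Measure X) (N : (X → ℝ) → ℝ≥0∞)
    (f : X → ℝ) : ℝ≥0∞ :=
  ⨆ (g : X → ℝ) (_ : Measurable g) (_ : N g ≤ 1), ∫⁻ x, ENNReal.ofReal |f x * g x| ∂μ

/-- The conjugate exponent: `q' = q/(q-1)` for `q ∈ (1,∞)`, `1' = ∞`, `∞' = 1`. -/
def conjE (q : ℝ≥0∞) : ℝ≥0∞ := (1 - q⁻¹)⁻¹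

/-- The interval `(0, μ(R))` inside `ℝ`, where `μ(R)` may be infinite. -/
def IooMu {X : Type*} [MeasurableSpace X] (μ : Measure X) : Set ℝ :=
  {t : ℝ | 0 < t ∧ ENNReal.ofReal t < μ Set.univ}

/-- The embedding `L^{p₁,q₁,b₁} ↪ L^{p₂,q₂,b₂}`. -/
def lkEmbed {X : Type*} [MeasurableSpace X] (μ : Measure X) (p1 q1 : ℝ≥0∞) (b1 : ℝ → ℝ)
    (p2 q2 : ℝ≥0∞) (b2 : ℝ → ℝ) : Prop :=
  ∃ C : ℝ≥0∞, C < ∞ ∧ ∀ f : X → ℝ, Measurable f →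
    lkNorm μ p2 q2 b2 f ≤ C * lkNorm μ p1 q1 b1 f

/-- A rearrangement-invariant quasi-Banach function norm. -/
structure IsRIQuasiBFN {X : Type*} [MeasurableSpace X] (μ : Measure X)
    (N : (X → ℝ) → ℝ≥0∞) : Prop where
  abs_eq : ∀ f : X → ℝ, Measurable f → N (fun x => |f x|) = N f
  smul : ∀ (a : ℝ) (f : X → ℝ), Measurable f →
    N (fun x => a * f x) = ENNReal.ofReal |a| * N f
  eq_zero_iff : ∀ f : X → ℝ, Measurable f → (N f = 0 ↔ f =ᵐ[μ] 0)
  quasi_add : ∃ C : ℝ≥0∞, C < ∞ ∧ ∀ f g : X → ℝ, Measurable f → Measurable g →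
    N (fun x => f x + g x) ≤ C * (N f + N g)
  mono : ∀ f g : X → ℝ, Measurable f → Measurable g →
    (∀ᵐ x ∂μ, |f x| ≤ |g x|) → N f ≤ N g
  fatou : ∀ (f : ℕ → X → ℝ) (g : X → ℝ), (∀ n, Measurable (f n)) → Measurable g →
    (∀ᵐ x ∂μ, ∀ n, 0 ≤ f n x) → (∀ᵐ x ∂μ, Monotone fun n => f n x) →
    (∀ᵐ x ∂μ, Filter.Tendsto (fun n => f n x) Filter.atTop (nhds (g x))) →
    N g = ⨆ n, N (f n)
  ind_lt_top : ∀ E : Set X, MeasurableSet E → μ E < ∞ →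
    N (Set.indicator E fun _ => (1:ℝ)) < ∞
  rearr_inv : ∀ f g : X → ℝ, Measurable f → Measurable g →
    rearr μ f = rearr μ g → N f = N g

/-- A rearrangement-invariant Banach function norm. -/
structure IsRIBFN {X : Type*} [MeasurableSpace X] (μ : Measure X)
    (N : (X → ℝ) → ℝ≥0∞) : Prop where
  abs_eq : ∀ f : X → ℝ, Measurable f → N (fun x => |f x|) = N f
  smul : ∀ (a : ℝ) (f : X → ℝ), Measurable f →
    N (fun x => a * f x) = ENNReal.ofReal |a| * N f
  eq_zero_iff : ∀ f : X → ℝ, Measurable f → (N f = 0 ↔ f =ᵐ[μ] 0)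
  add_le : ∀ f g : X → ℝ, Measurable f → Measurable g →
    N (fun x => f x + g x) ≤ N f + N g
  mono : ∀ f g : X → ℝ, Measurable f → Measurable g →
    (∀ᵐ x ∂μ, |f x| ≤ |g x|) → N f ≤ N g
  fatou : ∀ (f : ℕ → X → ℝ) (g : X → ℝ), (∀ n, Measurable (f n)) → Measurable g →
    (∀ᵐ x ∂μ, ∀ n, 0 ≤ f n x) → (∀ᵐ x ∂μ, Monotone fun n => f n x) →
    (∀ᵐ x ∂μ, Filter.Tendsto (fun n => f n x) Filter.atTop (nhds (g x))) →
    N g = ⨆ n, N (f n)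
  ind_lt_top : ∀ E : Set X, MeasurableSet E → μ E < ∞ →
    N (Set.indicator E fun _ => (1:ℝ)) < ∞
  integral_le : ∀ E : Set X, MeasurableSet E → μ E < ∞ →
    ∃ C : ℝ≥0∞, C < ∞ ∧ ∀ f : X → ℝ, Measurable f →
      ∫⁻ x in E, ENNReal.ofReal |f x| ∂μ ≤ C * N f
  rearr_inv : ∀ f g : X → ℝ, Measurable f → Measurable g →
    rearr μ f = rearr μ g → N f = N g

end

section Realization

variable {X : Type*} [MeasurableSpace X] {μ : Measure X}

lemma IsNonatomic.exists_subset_measure_le (hna : IsNonatomic μ) {S : Set X}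
    (hS : MeasurableSet S) (h0 : 0 < μ S) {ε : ℝ≥0∞} (hε : ε ≠ 0) :
    ∃ T ⊆ S, MeasurableSet T ∧ 0 < μ T ∧ μ T ≤ ε := by
  obtain ⟨U, hUS, hU, hU0, hUlt⟩ := hna S hS h0
  have halving : ∀ V, MeasurableSet V → 0 < μ V → μ V < ∞ →
      ∃ W ⊆ V, MeasurableSet W ∧ 0 < μ W ∧ μ W ≤ μ V / 2 := by
    intro V hV hV0 hVt
    obtain ⟨W, hWV, hW, hW0, hWlt⟩ := hna V hV hV0
    rcases le_or_gt (μ W) (μ V / 2) with h | h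
    · exact ⟨W, hWV, hW, hW0, h⟩
    · have hd : μ (V \ W) = μ V - μ W := measure_sdiff hWV hW.nullMeasurableSet (hWlt.trans hVt).ne
      refine ⟨V \ W, sdiff_subset, hV.diff hW, ?_, ?_⟩
      · rw [hd]; exact tsub_pos_of_lt hWlt
      · rw [hd, tsub_le_iff_right]
        calc μ V = μ V / 2 + μ V / 2 := (ENNReal.add_halves _).symm
          _ ≤ μ V / 2 + μ W := by gcongr
  have iter : ∀ n : ℕ, ∃ W ⊆ U, MeasurableSet W ∧ 0 < μ W ∧ μ W ≤ μ U * (2⁻¹) ^ n := by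
    intro n
    induction n with
    | zero => exact ⟨U, subset_rfl, hU, hU0, by simp⟩
    | succ n ih =>
      obtain ⟨W, hWU, hW, hW0, hWle⟩ := ih
      obtain ⟨W', hW'W, hW', hW'0, hW'le⟩ := halving W hW hW0
        ((measure_mono hWU).trans_lt (hUlt.trans_le le_top))
      refine ⟨W', hW'W.trans hWU, hW', hW'0, hW'le.trans ?_⟩
      rw [pow_succ, ← mul_assoc, div_eq_mul_inv]
      gcongr
  have hlim : Tendsto (fun n : ℕ => μ U * (2⁻¹ : ℝ≥0∞) ^ n) atTop (𝓝 0) := by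
    have := ENNReal.Tendsto.const_mul (a := μ U)
      (ENNReal.tendsto_pow_atTop_nhds_zero_of_lt_one (r := 2⁻¹) (by simp))
      (Or.inr (hUlt.trans_le le_top).ne)
    simpa using this
  obtain ⟨n, hn⟩ := (hlim.eventually (gt_mem_nhds (pos_iff_ne_zero.2 hε))).exists
  obtain ⟨W, hWU, hW, hW0, hWle⟩ := iter n
  exact ⟨W, hWU.trans hUS, hW, hW0, hWle.trans hn.le⟩

/-- Intermediate value property of non-atomic measures. -/
lemma IsNonatomic.exists_subset_measure_eq (hna : IsNonatomic μ) {S : Set X}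
    (hS : MeasurableSet S) {r : ℝ≥0∞} (hr : r ≤ μ S) (hrt : r ≠ ∞) :
    ∃ T ⊆ S, MeasurableSet T ∧ μ T = r := by
  let good : Set X → Prop := fun T => T ⊆ S ∧ MeasurableSet T ∧ μ T ≤ r
  have step : ∀ (n : ℕ) (T : {T // good T}), ∃ T' : {T // good T}, T.1 ⊆ T'.1 ∧
      ∀ T'' : {T // good T}, T.1 ⊆ T''.1 → μ T''.1 ≤ μ T'.1 + (2⁻¹) ^ n := by
    intro n T
    by_contra! hcon
    have hsup : (⨆ T' : {T' : {T // good T} // T.1 ⊆ T'.1}, μ T'.1.1) ≤ r :=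
      iSup_le fun T' => T'.1.2.2.2
    set m := ⨆ T' : {T' : {T // good T} // T.1 ⊆ T'.1}, μ T'.1.1 with hm
    have hpow : ((2⁻¹ : ℝ≥0∞)) ^ n ≠ 0 := by simp
    have key : ∀ T' : {T' : {T // good T} // T.1 ⊆ T'.1}, μ T'.1.1 ≤ m - (2⁻¹) ^ n := by
      intro T'
      obtain ⟨T'', h1, h2⟩ := hcon T'.1 T'.2
      refine ENNReal.le_sub_of_add_le_right (by finiteness) (h2.le.trans ?_)
      exact le_iSup (fun T' : {T' : {T // good T} // T.1 ⊆ T'.1} => μ T'.1.1) ⟨T'', h1⟩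
    have hle : m ≤ m - (2⁻¹) ^ n := iSup_le key
    have hm0 : m = 0 := by
      by_contra h0
      exact (ENNReal.sub_lt_self (ne_top_of_le_ne_top hrt hsup) h0 hpow).not_ge hle
    obtain ⟨T'', h1, h2⟩ := hcon T subset_rfl
    have : μ T''.1 ≤ m :=
      le_iSup (fun T' : {T' : {T // good T} // T.1 ⊆ T'.1} => μ T'.1.1) ⟨T'', h1⟩
    rw [hm0] at this
    exact (h2.trans_le this).not_ge zero_le
  choose next hsub hnext using step
  let T : ℕ → {T // good T} :=
    fun n => Nat.rec ⟨∅, empty_subset _, MeasurableSet.empty, by simp⟩ (fun k U => next k U) n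
  have hmono : Monotone fun n => (T n).1 := monotone_nat_of_le_succ fun n => hsub n (T n)
  have hU : good (⋃ n, (T n).1) := by
    refine ⟨iUnion_subset fun n => (T n).2.1, MeasurableSet.iUnion fun n => (T n).2.2.1, ?_⟩
    rw [hmono.measure_iUnion]
    exact iSup_le fun n => (T n).2.2.2
  refine ⟨⋃ n, (T n).1, hU.1, hU.2.1, ?_⟩
  by_contra hne
  have hlt : μ (⋃ n, (T n).1) < r := lt_of_le_of_ne hU.2.2 hne
  set V := ⋃ n, (T n).1 with hV
  have hd : 0 < μ (S \ V) := by
    refine (tsub_pos_of_lt (hlt.trans_le hr)).trans_le ?_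
    exact le_measure_sdiff
  obtain ⟨D, hDS, hD, hD0, hDle⟩ := hna.exists_subset_measure_le (hS.diff hU.2.1) hd
    (tsub_pos_of_lt hlt).ne'
  have hdisj : Disjoint V D := disjoint_sdiff_right.mono_right hDS
  have hVD : μ (V ∪ D) = μ V + μ D := measure_union hdisj hD
  have hgood : good (V ∪ D) := by
    refine ⟨union_subset hU.1 (hDS.trans sdiff_subset), hU.2.1.union hD, ?_⟩
    rw [hVD]
    calc μ V + μ D ≤ μ V + (r - μ V) := by gcongr
      _ = r := add_tsub_cancel_of_le hlt.le
  have hbound : ∀ n : ℕ, μ (V ∪ D) ≤ μ V + (2⁻¹) ^ n := by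
    intro n
    refine (hnext n (T n) ⟨V ∪ D, hgood⟩
      ((subset_iUnion (fun n => (T n).1) n).trans subset_union_left)).trans ?_
    gcongr
    exact subset_iUnion (fun n => (T n).1) (n + 1)
  have hlim : Tendsto (fun n : ℕ => μ V + (2⁻¹ : ℝ≥0∞) ^ n) atTop (𝓝 (μ V + 0)) :=
    tendsto_const_nhds.add (ENNReal.tendsto_pow_atTop_nhds_zero_of_lt_one (by simp))
  have hle := ge_of_tendsto' hlim hbound
  rw [hVD, add_zero] at hle
  exact (ENNReal.lt_add_right hlt.ne_top hD0.ne').not_ge hle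

lemma IsNonatomic.exists_monotone_measure_eq (hna : IsNonatomic μ) (hμ : μ univ = ∞) :
    ∃ B : ℕ → Set X, Monotone B ∧ (∀ n, MeasurableSet (B n)) ∧ ∀ n, μ (B n) = n := by
  have step : ∀ B : {B : Set X // MeasurableSet B ∧ μ B ≠ ∞}, ∃ B' : {B // MeasurableSet B ∧ μ B ≠ ∞},
      B.1 ⊆ B'.1 ∧ μ B'.1 = μ B.1 + 1 := by
    rintro ⟨B, hB, hBt⟩
    have hc : μ Bᶜ = ∞ := by rw [measure_compl hB hBt, hμ, ENNReal.top_sub hBt]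
    obtain ⟨T, hTB, hT, hT1⟩ := hna.exists_subset_measure_eq (r := 1) hB.compl (by simp [hc]) (by simp)
    have h : μ (B ∪ T) = μ B + 1 := by
      rw [measure_union (disjoint_compl_right.mono_right hTB) hT, hT1]
    exact ⟨⟨B ∪ T, hB.union hT, by rw [h]; finiteness⟩, subset_union_left, h⟩
  choose next hsub hnext using step
  let B : ℕ → {B : Set X // MeasurableSet B ∧ μ B ≠ ∞} :=
    fun n => Nat.rec ⟨∅, MeasurableSet.empty, by simp⟩ (fun _ U => next U) n
  refine ⟨fun n => (B n).1, monotone_nat_of_le_succ fun n => hsub (B n), fun n => (B n).2.1, ?_⟩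
  intro n
  induction n with
  | zero => simp [B]
  | succ n ih =>
    rw [Nat.cast_succ, ← ih]
    exact hnext (B n)

/-- On a non-atomic space of infinite measure, every finite non-increasing step function with unit
steps is a rearrangement. -/
lemma IsNonatomic.exists_rearr_eq (hna : IsNonatomic μ) (hμ : μ univ = ∞) {c : ℕ → ℝ≥0∞}
    (hc : Antitone c) (hc0 : c 0 ≠ ∞) :
    ∃ f : X → ℝ, Measurable f ∧ ∀ t : ℝ, 0 ≤ t → rearr μ f t = c ⌊t⌋₊ := by
  obtain ⟨B, hBm, hB, hBn⟩ := hna.exists_monotone_measure_eq hμ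
  let F : X → ℝ≥0∞ := fun x => ⨆ n, (B (n + 1)).indicator (fun _ => c n) x
  have hFt : ∀ x, F x ≠ ∞ := fun x => by
    refine ne_top_of_le_ne_top hc0 (iSup_le fun n => ?_)
    exact (indicator_le_self _ _ _).trans (hc (Nat.zero_le n))
  refine ⟨fun x => (F x).toReal, ?_, ?_⟩
  · exact (Measurable.iSup fun n => measurable_const.indicator (hB (n + 1))).ennreal_toReal
  intro t ht
  have hset : ∀ s : ℝ≥0∞, {x | s < ENNReal.ofReal |(F x).toReal|} =
      ⋃ n, {x | s < c n ∧ x ∈ B (n + 1)} := by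
    intro s
    ext x
    simp only [abs_of_nonneg ENNReal.toReal_nonneg, ENNReal.ofReal_toReal (hFt x), mem_ofPred_eq,
      mem_iUnion, F, lt_iSup_iff]
    refine exists_congr fun n => ?_
    by_cases hx : x ∈ B (n + 1) <;> simp [hx]
  unfold rearr
  refine le_antisymm (sInf_le ?_) (le_sInf ?_)
  · rw [mem_ofPred_eq, hset]
    calc μ (⋃ n, {x | c ⌊t⌋₊ < c n ∧ x ∈ B (n + 1)}) ≤ μ (B ⌊t⌋₊) := by
          refine measure_mono (iUnion_subset fun n x hx => ?_)
          have : n < ⌊t⌋₊ := hc.reflect_lt hx.1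
          exact hBm this hx.2
      _ = ENNReal.ofReal ⌊t⌋₊ := by rw [hBn, ENNReal.ofReal_natCast]
      _ ≤ ENNReal.ofReal t := ENNReal.ofReal_le_ofReal (Nat.floor_le ht)
  · intro s hs
    by_contra! hlt
    rw [mem_ofPred_eq, hset] at hs
    have h1 : μ (B (⌊t⌋₊ + 1)) ≤ ENNReal.ofReal t :=
      
      (measure_mono fun x hx => (mem_iUnion.2 ⟨⌊t⌋₊, hlt, hx⟩ :
        x ∈ ⋃ n, {x | s < c n ∧ x ∈ B (n + 1)})).trans hs
    rw [hBn, ← ENNReal.ofReal_natCast, ENNReal.ofReal_le_ofReal_iff ht] at h1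
    push_cast at h1
    exact (Nat.lt_floor_add_one t).not_ge h1

end Realization

section SlowlyVarying

variable {b : ℝ → ℝ}

/-- Potter-type bounds. -/
lemma IsSlowlyVarying.exists_potter (hb : IsSlowlyVarying b) {ε : ℝ} (hε : 0 < ε) :
    ∃ K : ℝ, 0 < K ∧ ∀ s t : ℝ, 0 < s → s ≤ t →
      b t ≤ K * (t / s) ^ ε * b s ∧ b s ≤ K * (t / s) ^ ε * b t := by
  obtain ⟨⟨bp, hbp, c, C, hc, hC, hp⟩, ⟨bm, hbm, c', C', hc', hC', hm⟩⟩ := hb.2.2 ε hε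
  have hcC : 0 < C / c := by positivity
  have hcC' : 0 < C' / c' := by positivity
  refine ⟨C / c + C' / c', by positivity, fun s t hs hst => ?_⟩
  have ht : 0 < t := hs.trans_le hst
  have hbs := hb.2.1 s hs
  have hbt := hb.2.1 t ht
  have hsε : 0 < s ^ ε := Real.rpow_pos_of_pos hs ε
  have htε : 0 < t ^ ε := Real.rpow_pos_of_pos ht ε
  rw [Real.div_rpow ht.le hs.le]
  constructor
  · have h1 : c' * (t ^ (-ε) * b t) ≤ C' * (s ^ (-ε) * b s) :=
      calc c' * (t ^ (-ε) * b t) ≤ c' * (C' * bm t) := mul_le_mul_of_nonneg_left (hm t ht).2 hc'.le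
        _ ≤ c' * (C' * bm s) := by gcongr; exact hbm hs ht hst
        _ = C' * (c' * bm s) := by ring
        _ ≤ C' * (s ^ (-ε) * b s) := mul_le_mul_of_nonneg_left (hm s hs).1 hC'.le
    rw [Real.rpow_neg ht.le, Real.rpow_neg hs.le] at h1
    calc b t = (t ^ ε / c') * (c' * ((t ^ ε)⁻¹ * b t)) := by field_simp
      _ ≤ (t ^ ε / c') * (C' * ((s ^ ε)⁻¹ * b s)) := by gcongr
      _ = (C' / c') * (t ^ ε / s ^ ε) * b s := by field_simp
      _ ≤ (C / c + C' / c') * (t ^ ε / s ^ ε) * b s := by gcongr; linarith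
  · have h1 : c * (s ^ ε * b s) ≤ C * (t ^ ε * b t) :=
      calc c * (s ^ ε * b s) ≤ c * (C * bp s) := mul_le_mul_of_nonneg_left (hp s hs).2 hc.le
        _ ≤ c * (C * bp t) := by gcongr; exact hbp hs ht hst
        _ = C * (c * bp t) := by ring
        _ ≤ C * (t ^ ε * b t) := mul_le_mul_of_nonneg_left (hp t ht).1 hC.le
    calc b s = (1 / (s ^ ε * c)) * (c * (s ^ ε * b s)) := by field_simp
      _ ≤ (1 / (s ^ ε * c)) * (C * (t ^ ε * b t)) := by gcongr
      _ = (C / c) * (t ^ ε / s ^ ε) * b t := by field_simp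
      _ ≤ (C / c + C' / c') * (t ^ ε / s ^ ε) * b t := by gcongr; linarith

end SlowlyVarying

section LqNorm

lemma lqNorm_mono {q : ℝ≥0∞} {S : Set ℝ} (hS : MeasurableSet S) {g h : ℝ → ℝ≥0∞}
    (hgh : ∀ t ∈ S, g t ≤ h t) : lqNorm q S g ≤ lqNorm q S h := by
  unfold lqNorm
  split_ifs with hq
  · exact essSup_mono_ae ((ae_restrict_iff' hS).2 (.of_forall hgh))
  · refine ENNReal.rpow_le_rpow (setLIntegral_mono' hS fun t ht => ?_) (by positivity)
    exact ENNReal.rpow_le_rpow (hgh t ht) (by positivity)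

lemma lqNorm_const_mul {q : ℝ≥0∞} (hq : 0 < q) {S : Set ℝ} {c : ℝ≥0∞} (hc : c ≠ ∞)
    (h : ℝ → ℝ≥0∞) : lqNorm q S (fun t => c * h t) = c * lqNorm q S h := by
  unfold lqNorm
  split_ifs with hq'
  · exact ENNReal.essSup_const_mul
  · have hq0 : 0 < q.toReal := ENNReal.toReal_pos hq.ne' hq'
    simp_rw [ENNReal.mul_rpow_of_nonneg _ _ hq0.le]
    rw [lintegral_const_mul' _ _ (by finiteness), ENNReal.mul_rpow_of_nonneg _ _ (by positivity),
      ← ENNReal.rpow_mul, mul_one_div_cancel hq0.ne', ENNReal.rpow_one]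

lemma map_mul_left_restrict_Ioi {l : ℝ} (hl : 0 < l) :
    Measure.map (fun x => l * x) (volume.restrict (Ioi (0 : ℝ))) =
      ENNReal.ofReal l⁻¹ • volume.restrict (Ioi 0) := by
  have hpre : (fun x => l * x) ⁻¹' Ioi (0 : ℝ) = Ioi 0 := by
    ext x; simp [hl]
  conv_lhs => rw [← hpre]
  rw [← Measure.restrict_map (measurable_const_mul l) measurableSet_Ioi,
    Real.map_volume_mul_left hl.ne', Measure.restrict_smul, abs_of_pos (inv_pos.2 hl)]

lemma lqNorm_comp_mul_left {q : ℝ≥0∞} (hq : 0 < q) {l : ℝ} (hl : 0 < l) {h : ℝ → ℝ≥0∞}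
    (hh : Measurable h) :
    lqNorm q (Ioi 0) (fun t => h (l * t)) =
      ENNReal.ofReal (l ^ (-q⁻¹.toReal)) * lqNorm q (Ioi 0) h := by
  have hl' : ENNReal.ofReal l⁻¹ ≠ 0 := by simpa using hl
  unfold lqNorm
  split_ifs with hq'
  · have := essSup_map_measure_of_measurable (μ := volume.restrict (Ioi (0 : ℝ))) hh
      (measurable_const_mul l).aemeasurable
    rw [map_mul_left_restrict_Ioi hl, essSup_ennreal_smul_measure hl'] at this
    rw [this]
    simp [hq', Function.comp_def]
  · have hq0 : 0 < q.toReal := ENNReal.toReal_pos hq.ne' hq'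
    have := lintegral_map (μ := volume.restrict (Ioi (0 : ℝ))) (hh.pow_const q.toReal)
      (measurable_const_mul l)
    rw [map_mul_left_restrict_Ioi hl, lintegral_smul_measure] at this
    rw [← this, smul_eq_mul, ENNReal.mul_rpow_of_nonneg _ _ (by positivity),
      ENNReal.ofReal_rpow_of_pos (by positivity), ENNReal.toReal_inv, Real.rpow_neg hl.le,
      Real.inv_rpow hl.le, one_div]

lemma le_tsum_rpow_rpow_inv {ι : Type*} {q : ℝ} (hq : 0 < q) (z : ι → ℝ≥0∞) (j : ι) :
    z j ≤ (∑' j, z j ^ q) ^ q⁻¹ := by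
  rw [← ENNReal.rpow_le_rpow_iff hq, ← ENNReal.rpow_mul, inv_mul_cancel₀ hq.ne', ENNReal.rpow_one]
  exact ENNReal.le_tsum j

lemma tsum_mul_rpow_le {ι : Type*} {q : ℝ} (hq : 0 < q) (u z : ι → ℝ≥0∞) :
    (∑' j, u j * z j) ^ q ≤ (∑' j, u j) ^ q * ∑' j, z j ^ q := by
  calc (∑' j, u j * z j) ^ q ≤ (∑' j, u j * (∑' j, z j ^ q) ^ q⁻¹) ^ q := by
        gcongr with j; exact le_tsum_rpow_rpow_inv hq z j
    _ = (∑' j, u j) ^ q * ∑' j, z j ^ q := by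
        rw [ENNReal.tsum_mul_right, ENNReal.mul_rpow_of_nonneg _ _ hq.le, ← ENNReal.rpow_mul,
          inv_mul_cancel₀ hq.ne', ENNReal.rpow_one]

lemma iSup_rpow_le_tsum {ι : Type*} {q : ℝ} (hq : 0 < q) (z : ι → ℝ≥0∞) :
    (⨆ j, z j) ^ q ≤ ∑' j, z j ^ q := by
  have := ENNReal.rpow_le_rpow (iSup_le (le_tsum_rpow_rpow_inv hq z)) hq.le
  rwa [← ENNReal.rpow_mul, inv_mul_cancel₀ hq.ne', ENNReal.rpow_one] at this

lemma tsum_geometric_ne_top {s : ℝ≥0∞} (hs : s < 1) : ∑' j : ℕ, s ^ j ≠ ∞ := by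
  rw [ENNReal.tsum_geometric]
  exact ENNReal.inv_ne_top.2 (tsub_pos_of_lt hs).ne'

lemma lqNorm_tsum_lt_top {q : ℝ≥0∞} (hq : 0 < q) {S : Set ℝ} {h : ℕ → ℝ → ℝ≥0∞}
    (hh : ∀ j, Measurable (h j)) {M s : ℝ≥0∞} (hM : M ≠ ∞) (hs : s < 1) (hs0 : s ≠ 0)
    (hle : ∀ j, lqNorm q S (h j) ≤ M * (s * s) ^ j) :
    lqNorm q S (fun t => ∑' j, h j t) < ∞ := by
  have hst : s ≠ ∞ := (hs.trans ENNReal.one_lt_top).ne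
  unfold lqNorm at hle ⊢
  split_ifs at hle ⊢ with hq'
  · have hae : ∀ᵐ t ∂(volume.restrict S), ∀ j, h j t ≤ M * (s * s) ^ j := by
      rw [ae_all_iff]
      exact fun j => (ENNReal.ae_le_essSup (h j)).mono fun t ht => ht.trans (hle j)
    have : essSup (fun t => ∑' j, h j t) (volume.restrict S) ≤ ∑' j, M * (s * s) ^ j :=
      essSup_le_of_ae_le _ (hae.mono fun t ht => ENNReal.tsum_le_tsum ht)
    refine this.trans_lt ?_
    rw [ENNReal.tsum_mul_left]
    exact ENNReal.mul_lt_top hM.lt_top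
      (tsum_geometric_ne_top (mul_lt_one_of_nonneg_of_lt_one_left (zero_le) hs hs.le)).lt_top
  · have hq0 : 0 < q.toReal := ENNReal.toReal_pos hq.ne' hq'
    set r := q.toReal
    refine ENNReal.rpow_lt_top_of_nonneg (by positivity) (ne_of_lt ?_)
    have hle' : ∀ j, ∫⁻ t in S, h j t ^ r ≤ (M * (s * s) ^ j) ^ r := fun j => by
      have := ENNReal.rpow_le_rpow (hle j) hq0.le
      rwa [← ENNReal.rpow_mul, one_div_mul_cancel hq0.ne', ENNReal.rpow_one] at this
    calc ∫⁻ t in S, (∑' j, h j t) ^ r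
        = ∫⁻ t in S, (∑' j, s ^ j * ((s⁻¹) ^ j * h j t)) ^ r := by
          congr! 3 with t
          refine tsum_congr fun j => ?_
          rw [← mul_assoc, ← mul_pow, ENNReal.mul_inv_cancel hs0 hst, one_pow, one_mul]
      _ ≤ ∫⁻ t in S, (∑' j, s ^ j) ^ r * ∑' j, ((s⁻¹) ^ j * h j t) ^ r :=
          lintegral_mono fun t => tsum_mul_rpow_le hq0 _ _
      _ = (∑' j, s ^ j) ^ r * ∑' j, ((s⁻¹) ^ j) ^ r * ∫⁻ t in S, h j t ^ r := by
          rw [lintegral_const_mul' _ _ (by have := tsum_geometric_ne_top hs; finiteness),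
            lintegral_tsum fun j => (((hh j).const_mul _).pow_const r).aemeasurable]
          congr! 3 with j
          simp_rw [ENNReal.mul_rpow_of_nonneg _ _ hq0.le]
          rw [lintegral_const_mul' _ _ (by finiteness)]
      _ ≤ (∑' j, s ^ j) ^ r * ∑' j, ((s⁻¹) ^ j) ^ r * (M * (s * s) ^ j) ^ r := by
          gcongr with j; exact hle' j
      _ = (∑' j, s ^ j) ^ r * (M ^ r * ∑' j, (s ^ r) ^ j) := by
          congr 1
          rw [← ENNReal.tsum_mul_left]
          congr! 2 with j
          rw [← ENNReal.mul_rpow_of_nonneg _ _ hq0.le, mul_left_comm, ← mul_pow, ← mul_assoc,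
            ENNReal.inv_mul_cancel hs0 hst, one_mul, ENNReal.mul_rpow_of_nonneg _ _ hq0.le,
            ← ENNReal.rpow_natCast, ← ENNReal.rpow_natCast, ← ENNReal.rpow_mul, ← ENNReal.rpow_mul,
            mul_comm r]
      _ < ∞ := by
          have h1 := tsum_geometric_ne_top hs
          have h2 := tsum_geometric_ne_top (ENNReal.rpow_lt_one hs hq0)
          finiteness

end LqNorm

section Hardy

lemma rearr_antitone {X : Type*} [MeasurableSpace X] (μ : Measure X) (f : X → ℝ) :
    Antitone (rearr μ f) := fun _ _ hst =>
  sInf_le_sInf fun _ hx => le_trans hx (ENNReal.ofReal_le_ofReal hst)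

lemma rearr_le_maxf {X : Type*} [MeasurableSpace X] (μ : Measure X) (f : X → ℝ) {t : ℝ}
    (ht : 0 < t) : rearr μ f t ≤ maxf μ f t := by
  have ht' : ENNReal.ofReal t ≠ 0 := by simpa using ht
  calc rearr μ f t
      = (ENNReal.ofReal t)⁻¹ * ∫⁻ _ in Ioo (0 : ℝ) t, rearr μ f t := by
        rw [setLIntegral_const, Real.volume_Ioo, sub_zero, mul_comm (rearr μ f t), ← mul_assoc,
          ENNReal.inv_mul_cancel ht' ENNReal.ofReal_ne_top, one_mul]
    _ ≤ maxf μ f t := by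
        unfold maxf
        gcongr 1
        exact setLIntegral_mono' measurableSet_Ioo fun s hs => rearr_antitone μ f hs.2.le

lemma setLIntegral_Ioo_le_tsum {g : ℝ → ℝ≥0∞} (hg : Antitone g) {t : ℝ} (ht : 0 < t) :
    ∫⁻ s in Ioo (0 : ℝ) t, g s ≤
      ∑' j : ℕ, ENNReal.ofReal ((1 / 2) ^ (j + 1) * t) * g ((1 / 2) ^ (j + 1) * t) := by
  have hsub : Ioo (0 : ℝ) t ⊆ ⋃ j : ℕ, Ioc ((1 / 2) ^ (j + 1) * t) ((1 / 2) ^ j * t) := by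
    intro s hs
    obtain ⟨n, h1, h2⟩ := exists_nat_pow_near_of_lt_one (div_pos hs.1 ht)
      ((div_le_one ht).2 hs.2.le) (show (0 : ℝ) < 1 / 2 by norm_num) (by norm_num)
    exact mem_iUnion.2 ⟨n, (lt_div_iff₀ ht).1 h1, (div_le_iff₀ ht).1 h2⟩
  calc ∫⁻ s in Ioo (0 : ℝ) t, g s
      ≤ ∑' j : ℕ, ∫⁻ s in Ioc ((1 / 2) ^ (j + 1) * t) ((1 / 2) ^ j * t), g s :=
        (lintegral_mono_set hsub).trans (lintegral_iUnion_le _ _)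
    _ ≤ ∑' j : ℕ, ENNReal.ofReal ((1 / 2) ^ (j + 1) * t) * g ((1 / 2) ^ (j + 1) * t) := by
        gcongr with j
        calc ∫⁻ s in Ioc ((1 / 2) ^ (j + 1) * t) ((1 / 2) ^ j * t), g s
            ≤ ∫⁻ _ in Ioc ((1 / 2) ^ (j + 1) * t) ((1 / 2) ^ j * t), g ((1 / 2) ^ (j + 1) * t) :=
              setLIntegral_mono' measurableSet_Ioc fun s hs => hg hs.1.le
          _ = _ := by
              rw [setLIntegral_const, Real.volume_Ioc, mul_comm]
              congr 2
              ring

lemma maxf_le_tsum {X : Type*} [MeasurableSpace X] (μ : Measure X) (f : X → ℝ) {t : ℝ}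
    (ht : 0 < t) :
    maxf μ f t ≤
      ∑' j : ℕ, ENNReal.ofReal ((1 / 2) ^ (j + 1)) * rearr μ f ((1 / 2) ^ (j + 1) * t) := by
  have ht' : ENNReal.ofReal t ≠ 0 := by simpa using ht
  refine (mul_le_mul_right (setLIntegral_Ioo_le_tsum (rearr_antitone μ f) ht) _).trans_eq ?_
  rw [← ENNReal.tsum_mul_left]
  congr! 2 with j
  rw [ENNReal.ofReal_mul (by positivity), ← mul_assoc, mul_left_comm,
    ENNReal.inv_mul_cancel ht' ENNReal.ofReal_ne_top, mul_one]

/-- The weight `t ^ a * b t` as an extended nonnegative function. -/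
noncomputable def powWeight (a : ℝ) (b : ℝ → ℝ) (t : ℝ) : ℝ≥0∞ := ENNReal.ofReal (t ^ a * b t)

lemma IsSlowlyVarying.measurable_powWeight {b : ℝ → ℝ} (hb : IsSlowlyVarying b) (a : ℝ) :
    Measurable (powWeight a b) :=
  ((measurable_id.pow_const a).mul hb.1).ennreal_ofReal

lemma IsSlowlyVarying.powWeight_le {b : ℝ → ℝ} (hb : IsSlowlyVarying b) (a : ℝ) {ε : ℝ}
    (hε : 0 < ε) :
    ∃ K : ℝ, 0 < K ∧ ∀ t l : ℝ, 0 < t → 0 < l → l ≤ 1 →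
      powWeight a b t ≤ ENNReal.ofReal (K * l ^ (-(a + ε))) * powWeight a b (l * t) := by
  obtain ⟨K, hK, h⟩ := hb.exists_potter hε
  refine ⟨K, hK, fun t l ht hl hl1 => ?_⟩
  have hlt : 0 < l * t := by positivity
  have hle : l * t ≤ t := by nlinarith
  unfold powWeight
  rw [← ENNReal.ofReal_mul (by positivity)]
  refine ENNReal.ofReal_le_ofReal ?_
  calc t ^ a * b t ≤ t ^ a * (K * (t / (l * t)) ^ ε * b (l * t)) := by
        gcongr; exact (h _ _ hlt hle).1
    _ = K * l ^ (-(a + ε)) * ((l * t) ^ a * b (l * t)) := by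
        rw [show t / (l * t) = l⁻¹ by field_simp, Real.mul_rpow hl.le ht.le, Real.inv_rpow hl.le,
          neg_add, Real.rpow_add hl, Real.rpow_neg hl.le, Real.rpow_neg hl.le]
        have := Real.rpow_pos_of_pos hl a
        field_simp

lemma lkNorm_le_lkMaxNorm {X : Type*} [MeasurableSpace X] (μ : Measure X) (p q : ℝ≥0∞)
    (b : ℝ → ℝ) (f : X → ℝ) : lkNorm μ p q b f ≤ lkMaxNorm μ p q b f :=
  lqNorm_mono measurableSet_Ioi fun _ ht => by gcongr; exact rearr_le_maxf μ f ht

lemma lkMaxNorm_lt_top {X : Type*} [MeasurableSpace X] {μ : Measure X} {p q : ℝ≥0∞}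
    (hp : 1 < p) (hq : 0 < q) {b : ℝ → ℝ} (hb : IsSlowlyVarying b) {f : X → ℝ}
    (hf : lkNorm μ p q b f < ∞) : lkMaxNorm μ p q b f < ∞ := by
  have hα : p⁻¹.toReal < 1 := by
    rw [← ENNReal.toReal_one]
    exact ENNReal.toReal_strict_mono ENNReal.one_ne_top (ENNReal.inv_lt_one.2 hp)
  set α := p⁻¹.toReal with hαdef
  set a := α - q⁻¹.toReal with ha
  have hε : 0 < (1 - α) / 2 := by linarith
  set ε := (1 - α) / 2 with hεdef
  obtain ⟨K, hK, hw⟩ := hb.powWeight_le a hε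
  have hgm : Measurable (rearr μ f) := (rearr_antitone μ f).measurable
  have hwm := hb.measurable_powWeight a
  change lqNorm q (Ioi 0) (fun t => powWeight a b t * rearr μ f t) < ∞ at hf
  change lqNorm q (Ioi 0) (fun t => powWeight a b t * maxf μ f t) < ∞
  set N := lqNorm q (Ioi 0) (fun t => powWeight a b t * rearr μ f t) with hN
  let h : ℕ → ℝ → ℝ≥0∞ := fun j t =>
    ENNReal.ofReal ((1 / 2) ^ (j + 1)) * (powWeight a b t * rearr μ f ((1 / 2) ^ (j + 1) * t))
  have hmono : lqNorm q (Ioi 0) (fun t => powWeight a b t * maxf μ f t) ≤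
      lqNorm q (Ioi 0) (fun t => ∑' j, h j t) := by
    refine lqNorm_mono measurableSet_Ioi fun t ht => ?_
    refine (mul_le_mul_right (maxf_le_tsum μ f ht) _).trans_eq ?_
    rw [← ENNReal.tsum_mul_left]
    congr! 2 with j
    exact mul_left_comm _ _ _
  refine hmono.trans_lt ?_
  have hhalf : (0 : ℝ) < 1 / 2 := by norm_num
  set s := ENNReal.ofReal ((1 / 2) ^ (ε / 2)) with hs
  have hs1 : s < 1 := by
    rw [hs, ENNReal.ofReal_lt_one]
    exact Real.rpow_lt_one hhalf.le (by norm_num) (by positivity)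
  have hss : s * s = ENNReal.ofReal ((1 / 2) ^ ε) := by
    rw [hs, ← ENNReal.ofReal_mul (by positivity), ← Real.rpow_add hhalf, add_halves]
  refine lqNorm_tsum_lt_top hq (s := s) (M := ENNReal.ofReal K * N)
    (fun j => ?_) (by finiteness) hs1 ?_ fun j => ?_
  · exact (hwm.mul (hgm.comp (measurable_const_mul _))).const_mul _
  · rw [hs]; simpa using Real.rpow_pos_of_pos hhalf _
  set l : ℝ := (1 / 2) ^ (j + 1) with hl
  have hl0 : 0 < l := by positivity
  have hl1 : l ≤ 1 := pow_le_one₀ hhalf.le (by norm_num)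
  calc lqNorm q (Ioi 0) (h j)
      ≤ lqNorm q (Ioi 0) (fun t => ENNReal.ofReal (l * (K * l ^ (-(a + ε)))) *
          (powWeight a b (l * t) * rearr μ f (l * t))) := by
        refine lqNorm_mono measurableSet_Ioi fun t ht => ?_
        rw [ENNReal.ofReal_mul hl0.le, mul_assoc (ENNReal.ofReal l), ← mul_assoc (ENNReal.ofReal (K * _))]
        simp only [h]
        gcongr
        exact hw t l ht hl0 hl1
    _ = ENNReal.ofReal (l * (K * l ^ (-(a + ε)))) * (ENNReal.ofReal (l ^ (-q⁻¹.toReal)) * N) := by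
        rw [lqNorm_const_mul hq ENNReal.ofReal_ne_top,
          lqNorm_comp_mul_left (h := fun t => powWeight a b t * rearr μ f t) hq hl0 (hwm.mul hgm)]
    _ = ENNReal.ofReal K * N * ENNReal.ofReal (l ^ ε) := by
        rw [← mul_assoc, ← ENNReal.ofReal_mul (by positivity), mul_right_comm (ENNReal.ofReal K) N,
          ← ENNReal.ofReal_mul hK.le]
        congr 2
        have : l ^ ε = l ^ (1 : ℝ) * l ^ (-(a + ε)) * l ^ (-q⁻¹.toReal) := by
          rw [← Real.rpow_add hl0, ← Real.rpow_add hl0]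
          congr 1
          rw [ha, hεdef]; ring
        rw [this, Real.rpow_one]
        ring
    _ ≤ ENNReal.ofReal K * N * (s * s) ^ j := by
        gcongr
        rw [hss, ← ENNReal.ofReal_pow (by positivity)]
        refine ENNReal.ofReal_le_ofReal ?_
        rw [hl, ← Real.rpow_natCast, ← Real.rpow_natCast, ← Real.rpow_mul hhalf.le,
          ← Real.rpow_mul hhalf.le]
        refine Real.rpow_le_rpow_of_exponent_ge hhalf (by norm_num) ?_
        push_cast
        nlinarith

end Hardy

section Dyadic

lemma not_geometric_decay {H : ℕ → ℝ} {θ : ℝ} (hθ : θ < 1) (h0 : ∀ n, 0 ≤ H n)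
    (hH : ∀ n, H (n + 1) ≤ θ * H n)
    (hlow : ∀ ρ : ℝ, 0 < ρ → ρ < 1 → ∃ c > 0, ∀ n, c * ρ ^ n ≤ H n) : False := by
  set τ := max θ (1 / 2) with hτ
  have hτ1 : τ < 1 := max_lt hθ (by norm_num)
  have hτ0 : 0 < τ := lt_of_lt_of_le (by norm_num) (le_max_right _ _)
  have hup : ∀ n, H n ≤ τ ^ n * H 0 := by
    intro n
    induction n with
    | zero => simp
    | succ n ih =>
      calc H (n + 1) ≤ θ * H n := hH n
        _ ≤ τ * H n := mul_le_mul_of_nonneg_right (le_max_left _ _) (h0 n)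
        _ ≤ τ * (τ ^ n * H 0) := by gcongr
        _ = τ ^ (n + 1) * H 0 := by ring
  obtain ⟨ρ, hτρ, hρ1⟩ := exists_between hτ1
  have hρ0 := hτ0.trans hτρ
  obtain ⟨c, hc, hle⟩ := hlow ρ hρ0 hρ1
  have hlim : Tendsto (fun n : ℕ => (τ / ρ) ^ n * H 0) atTop (𝓝 (0 * H 0)) :=
    (tendsto_pow_atTop_nhds_zero_of_lt_one (by positivity) ((div_lt_one hρ0).2 hτρ)).mul_const _
  rw [zero_mul] at hlim
  refine hc.not_ge (ge_of_tendsto' hlim fun n => ?_)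
  rw [div_pow, div_mul_eq_mul_div, le_div_iff₀ (by positivity)]
  exact (hle n).trans (hup n)

lemma IsSlowlyVarying.exists_doubling {b : ℝ → ℝ} (hb : IsSlowlyVarying b) :
    ∃ D : ℝ, 0 < D ∧ ∀ s t : ℝ, 0 < s → s ≤ t → t ≤ 2 * s → b t ≤ D * b s ∧ b s ≤ D * b t := by
  obtain ⟨K, hK, h⟩ := hb.exists_potter one_pos
  refine ⟨K * 2, by positivity, fun s t hs hst hts => ?_⟩
  have hd : (t / s) ^ (1 : ℝ) ≤ 2 := by rw [Real.rpow_one, div_le_iff₀ hs]; exact hts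
  have hbs := hb.2.1 s hs
  have hbt := hb.2.1 t (hs.trans_le hst)
  obtain ⟨h1, h2⟩ := h s t hs hst
  exact ⟨h1.trans (by gcongr), h2.trans (by gcongr)⟩

lemma IsSlowlyVarying.exists_mul_pow_le {b : ℝ → ℝ} (hb : IsSlowlyVarying b) {ρ : ℝ} (hρ0 : 0 < ρ)
    (hρ1 : ρ < 1) : ∃ c > 0, ∀ n : ℕ, c * ρ ^ n ≤ b (2 ^ n) := by
  have hlog : 0 < -Real.logb 2 ρ := neg_pos.2 (Real.logb_neg (by norm_num) hρ0 hρ1)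
  obtain ⟨K, hK, h⟩ := hb.exists_potter hlog
  have hb1 := hb.2.1 1 (mem_Ioi.2 one_pos)
  refine ⟨b 1 / K, by positivity, fun n => ?_⟩
  have h1 := (h 1 (2 ^ n) one_pos (one_le_pow₀ (by norm_num))).2
  have h2 : ((2 : ℝ) ^ n / 1) ^ (-Real.logb 2 ρ) = (ρ ^ n)⁻¹ := by
    rw [div_one, ← Real.rpow_natCast, ← Real.rpow_mul (by norm_num), mul_comm, Real.rpow_mul (by norm_num),
      Real.rpow_neg (by norm_num), Real.rpow_logb (by norm_num) (by norm_num) hρ0, Real.rpow_natCast,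
      inv_pow]
  rw [h2] at h1
  have : 0 < ρ ^ n := by positivity
  calc b 1 / K * ρ ^ n ≤ (K * (ρ ^ n)⁻¹ * b (2 ^ n)) / K * ρ ^ n := by gcongr
    _ = b (2 ^ n) := by field_simp

end Dyadic

section Endpoint

variable {X : Type*} [MeasurableSpace X] {μ : Measure X}

lemma exists_lkNorm_top_lt_top (hna : IsNonatomic μ) (hμ : μ univ = ∞) {p : ℝ≥0∞}
    (hα : 1 ≤ p⁻¹.toReal) {b : ℝ → ℝ} (hb : IsSlowlyVarying b) :
    ∃ f : X → ℝ, Measurable f ∧ lkNorm μ p ∞ b f < ∞ ∧ lkMaxNorm μ p ∞ b f = ∞ := by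
  set α := p⁻¹.toReal with hαdef
  obtain ⟨⟨B, hBmono, c₀, C₀, hc₀, hC₀, hB⟩, -⟩ := hb.2.2 α (by linarith)
  have hWpos : ∀ t : ℝ, 0 < t → 0 < t ^ α * b t := fun t ht =>
    mul_pos (Real.rpow_pos_of_pos ht α) (hb.2.1 t ht)
  have hBpos : ∀ t : ℝ, 0 < t → 0 < B t := fun t ht =>
    pos_of_mul_pos_right ((hWpos t ht).trans_le (hB t ht).2) hC₀.le
  let c : ℕ → ℝ≥0∞ := fun n => ENNReal.ofReal (B (n + 1))⁻¹
  have hc : Antitone c := fun m n hmn => by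
    refine ENNReal.ofReal_le_ofReal (inv_anti₀ (hBpos _ (by positivity)) ?_)
    exact hBmono (mem_Ioi.2 (by positivity)) (mem_Ioi.2 (by positivity)) (by gcongr)
  obtain ⟨f, hfm, hf⟩ := hna.exists_rearr_eq hμ hc ENNReal.ofReal_ne_top
  refine ⟨f, hfm, ?_, ?_⟩
  · refine lt_of_le_of_lt ?_ (ENNReal.ofReal_lt_top (r := C₀))
    simp only [lkNorm, lqNorm, if_true]
    refine essSup_le_of_ae_le _ ((ae_restrict_iff' measurableSet_Ioi).2 (.of_forall fun t ht => ?_))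
    rw [mem_Ioi] at ht
    simp only [ENNReal.inv_top, ENNReal.toReal_zero, sub_zero, hf t ht.le, c]
    rw [← ENNReal.ofReal_mul (hWpos t ht).le]
    refine ENNReal.ofReal_le_ofReal ?_
    have hB' := hBpos (⌊t⌋₊ + 1) (by positivity)
    rw [← div_eq_mul_inv, div_le_iff₀ hB']
    refine (hB t ht).2.trans ?_
    gcongr
    exact hBmono ht (mem_Ioi.2 (by positivity)) (Nat.lt_floor_add_one t).le
  by_contra hne
  set M := lkMaxNorm μ p ∞ b f with hM
  have hae : ∀ᵐ t ∂(volume.restrict (Ioi (0 : ℝ))),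
      ENNReal.ofReal (t ^ α * b t) * maxf μ f t ≤ M := by
    have := ENNReal.ae_le_essSup (μ := volume.restrict (Ioi (0 : ℝ)))
      (fun t => ENNReal.ofReal (t ^ (p⁻¹.toReal - (∞ : ℝ≥0∞)⁻¹.toReal) * b t) * maxf μ f t)
    simp only [hM, lkMaxNorm, lqNorm, if_true]
    simpa only [ENNReal.inv_top, ENNReal.toReal_zero, sub_zero] using this
  let G : ℝ → ℝ≥0∞ := fun t => ∫⁻ s in Ioo (0 : ℝ) t, rearr μ f s
  have hG : ∀ t, G t ≠ ∞ := fun t => by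
    refine ne_top_of_le_ne_top (b := c 0 * ENNReal.ofReal t) (by finiteness) ?_
    calc G t ≤ ∫⁻ _ in Ioo (0 : ℝ) t, c 0 := setLIntegral_mono' measurableSet_Ioo fun s hs => by
          rw [hf s hs.1.le]; exact hc (Nat.zero_le _)
      _ = c 0 * ENNReal.ofReal t := by rw [setLIntegral_const, Real.volume_Ioo, sub_zero]
  have hGup : ∀ n : ℕ, (G (2 ^ n)).toReal ≤ (2 * (M.toReal + 1) / c₀) * (2 ^ n / B (2 ^ n)) := by
    intro n
    have h2 : (0 : ℝ) < 2 ^ n := by positivity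
    have hae' : ∀ᵐ t ∂(volume.restrict (Ioo ((2 : ℝ) ^ n) (2 * 2 ^ n))),
        ENNReal.ofReal (t ^ α * b t) * maxf μ f t ≤ M :=
      ae_restrict_of_ae_restrict_of_subset (fun t ht => h2.trans ht.1) hae
    have hvol : (volume.restrict (Ioo ((2 : ℝ) ^ n) (2 * 2 ^ n))) ≠ 0 := by
      rw [Ne, Measure.restrict_eq_zero, Real.volume_Ioo]
      simp only [ENNReal.ofReal_eq_zero, not_le]
      linarith
    have : (ae (volume.restrict (Ioo ((2 : ℝ) ^ n) (2 * 2 ^ n)))).NeBot := ae_neBot.2 hvol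
    obtain ⟨t, htM, ht⟩ := (hae'.and (ae_restrict_mem measurableSet_Ioo)).exists
    have ht0 : 0 < t := h2.trans ht.1
    have hWt := hWpos t ht0
    have hreal : (t ^ α * b t) * (t⁻¹ * (G t).toReal) ≤ M.toReal := by
      have := ENNReal.toReal_mono hne htM
      rwa [maxf, ENNReal.toReal_mul, ENNReal.toReal_mul, ENNReal.toReal_inv,
        ENNReal.toReal_ofReal hWt.le, ENNReal.toReal_ofReal ht0.le] at this
    have hGt : (G (2 ^ n)).toReal ≤ (G t).toReal :=
      ENNReal.toReal_mono (hG t) (lintegral_mono_set (Ioo_subset_Ioo_right ht.1.le))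
    have hBn := hBpos _ h2
    have hBW : c₀ * B (2 ^ n) ≤ t ^ α * b t :=
      (mul_le_mul_of_nonneg_left (hBmono h2 ht0 ht.1.le) hc₀.le).trans (hB t ht0).1
    have h3 : c₀ * B (2 ^ n) * (G (2 ^ n)).toReal ≤ (M.toReal + 1) * (2 * 2 ^ n) := by
      calc c₀ * B (2 ^ n) * (G (2 ^ n)).toReal ≤ (t ^ α * b t) * (G t).toReal := by gcongr
        _ = (t ^ α * b t) * (t⁻¹ * (G t).toReal) * t := by field_simp
        _ ≤ M.toReal * t := by gcongr
        _ ≤ (M.toReal + 1) * (2 * 2 ^ n) := by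
          gcongr
          · linarith
          · exact ht.2.le
    rw [div_mul_div_comm, le_div_iff₀ (by positivity)]
    linarith
  obtain ⟨D, hD, hDb⟩ := hb.exists_doubling
  have hB2 : ∀ t : ℝ, 0 < t → B (2 * t) ≤ (2 ^ α * D * C₀ / c₀) * B t := by
    intro t ht
    have h2t : 0 < 2 * t := by positivity
    have h1 := (hB _ h2t).1
    have h2 := (hB t ht).2
    have h3 := (hDb t (2 * t) ht (by linarith) le_rfl).1
    have : c₀ * B (2 * t) ≤ 2 ^ α * D * C₀ * B t := by
      calc c₀ * B (2 * t) ≤ (2 * t) ^ α * b (2 * t) := h1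
        _ ≤ (2 * t) ^ α * (D * b t) := by gcongr
        _ = 2 ^ α * D * (t ^ α * b t) := by rw [Real.mul_rpow (by norm_num) ht.le]; ring
        _ ≤ 2 ^ α * D * (C₀ * B t) := mul_le_mul_of_nonneg_left h2 (by positivity)
        _ = _ := by ring
    rw [div_mul_eq_mul_div, le_div_iff₀ hc₀]
    linarith
  have hGstep : ∀ n : ℕ, (G (2 ^ n)).toReal + 2 ^ n / B (2 * 2 ^ n) ≤ (G (2 ^ (n + 1))).toReal := by
    intro n
    have h2 : (0 : ℝ) < 2 ^ n := by positivity
    have hBp := hBpos (2 * 2 ^ n) (by positivity)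
    have hE : G (2 ^ n) + ENNReal.ofReal (2 ^ n / B (2 * 2 ^ n)) ≤ G (2 ^ (n + 1)) := by
      have hsplit : G (2 ^ (n + 1)) = G (2 ^ n) + ∫⁻ s in Ico ((2 : ℝ) ^ n) (2 ^ (n + 1)), rearr μ f s := by
        have hU : Ioo (0 : ℝ) (2 ^ (n + 1)) = Ioo 0 (2 ^ n) ∪ Ico (2 ^ n) (2 ^ (n + 1)) :=
          (Ioo_union_Ico_eq_Ioo h2 (by rw [pow_succ]; linarith)).symm
        change ∫⁻ s in Ioo (0 : ℝ) (2 ^ (n + 1)), rearr μ f s = _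
        rw [hU, lintegral_union measurableSet_Ico]
        exact disjoint_left.2 fun x hx hx' => hx.2.not_ge hx'.1
      rw [hsplit]
      gcongr
      calc ENNReal.ofReal (2 ^ n / B (2 * 2 ^ n))
          = ∫⁻ _ in Ico ((2 : ℝ) ^ n) (2 ^ (n + 1)), ENNReal.ofReal (B (2 * 2 ^ n))⁻¹ := by
            rw [setLIntegral_const, Real.volume_Ico, ← ENNReal.ofReal_mul (by positivity)]
            congr 1
            ring
        _ ≤ _ := setLIntegral_mono' measurableSet_Ico fun s hs => by
            have hs0 : 0 ≤ s := h2.le.trans hs.1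
            rw [hf s hs0]
            refine ENNReal.ofReal_le_ofReal (inv_anti₀ (hBpos _ (by positivity)) ?_)
            refine hBmono (mem_Ioi.2 (by positivity)) (mem_Ioi.2 (by positivity)) ?_
            have : ⌊s⌋₊ < 2 ^ (n + 1) := by
              rw [Nat.floor_lt hs0]; push_cast; exact hs.2
            rw [← pow_succ']
            exact_mod_cast Nat.succ_le_of_lt this
    have := ENNReal.toReal_mono (hG _) hE
    rwa [ENNReal.toReal_add (hG _) ENNReal.ofReal_ne_top, ENNReal.toReal_ofReal (by positivity)] at this
  set E := 2 * (M.toReal + 1) / c₀ with hEdef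
  have hE : 0 < E := by have : 0 ≤ M.toReal := ENNReal.toReal_nonneg; positivity
  set F := 2 ^ α * D * C₀ / c₀ with hFdef
  have hF : 0 < F := by positivity
  clear_value E F
  have hGgrow : ∀ n : ℕ, (1 + 1 / (E * F)) * (G (2 ^ n)).toReal ≤ (G (2 ^ (n + 1))).toReal := by
    intro n
    have hBn := hBpos (2 ^ n) (by positivity)
    have hBn2 := hBpos (2 * 2 ^ n) (by positivity)
    refine le_trans ?_ (hGstep n)
    rw [add_mul, one_mul]
    gcongr
    calc 1 / (E * F) * (G (2 ^ n)).toReal ≤ 1 / (E * F) * (E * (2 ^ n / B (2 ^ n))) := by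
          gcongr; exact hGup n
      _ = 2 ^ n / (F * B (2 ^ n)) := by field_simp
      _ ≤ 2 ^ n / B (2 * 2 ^ n) := by gcongr; exact hB2 _ (by positivity)
  have hGpos : ∀ n : ℕ, 0 < (G (2 ^ n)).toReal := by
    intro n
    rcases n with _ | n
    · refine ENNReal.toReal_pos (ne_of_gt ?_) (hG _)
      calc 0 < c 0 * 1 := by simpa [c] using hBpos 1 one_pos
        _ = ∫⁻ _ in Ioo (0 : ℝ) 1, c 0 := by simp
        _ ≤ G (2 ^ 0) := by
          simp only [pow_zero, G]
          refine setLIntegral_mono' measurableSet_Ioo fun s hs => ?_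
          rw [hf s hs.1.le, Nat.floor_eq_zero.2 hs.2]
    · have := hBpos (2 * 2 ^ n) (by positivity)
      exact (by positivity : (0 : ℝ) < (G (2 ^ n)).toReal + 2 ^ n / B (2 * 2 ^ n)).trans_le (hGstep n)
  refine not_geometric_decay (H := fun n => ((G (2 ^ n)).toReal)⁻¹) (θ := (1 + 1 / (E * F))⁻¹)
    (inv_lt_one_of_one_lt₀ (by simp; positivity)) (fun n => (inv_pos.2 (hGpos n)).le) (fun n => ?_) ?_
  · rw [← mul_inv]
    have := hGpos n
    exact inv_anti₀ (by positivity) (hGgrow n)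
  intro ρ hρ0 hρ1
  obtain ⟨d, hd, hdle⟩ := hb.exists_mul_pow_le hρ0 hρ1
  refine ⟨d / (C₀ * E), by positivity, fun n => ?_⟩
  have hBn := hBpos (2 ^ n) (by positivity)
  have h2 : (1 : ℝ) ≤ 2 ^ n := one_le_pow₀ (by norm_num)
  have h1 : 2 ^ n * (d * ρ ^ n) ≤ C₀ * B (2 ^ n) := by
    refine le_trans ?_ (hB (2 ^ n) (by simp)).2
    have : (2 : ℝ) ^ n ≤ ((2 : ℝ) ^ n) ^ α := Real.self_le_rpow_of_one_le h2 hα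
    exact mul_le_mul this (hdle n) (by positivity) (by positivity)
  rw [le_inv_comm₀ (by positivity) (hGpos n)]
  refine (hGup n).trans ?_
  rw [div_mul_eq_mul_div, inv_div, mul_div_assoc', div_le_div_iff₀ hBn (by positivity)]
  calc E * 2 ^ n * (d * ρ ^ n) = E * (2 ^ n * (d * ρ ^ n)) := by ring
    _ ≤ E * (C₀ * B (2 ^ n)) := by gcongr
    _ = _ := by ring

lemma setLIntegral_Ioo_rpow {s R : ℝ} (hs : 0 < s) (hR : 0 < R) :
    ∫⁻ t in Ioo (0 : ℝ) R, ENNReal.ofReal (t ^ (s - 1)) = ENNReal.ofReal (R ^ s / s) := by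
  rw [← ofReal_integral_eq_lintegral_ofReal
    ((intervalIntegral.integrableOn_Ioo_rpow_iff hR).2 (by linarith))
    ((ae_restrict_iff' measurableSet_Ioo).2 (.of_forall fun t ht => Real.rpow_nonneg ht.1.le _)),
    ← integral_Ioc_eq_integral_Ioo, ← intervalIntegral.integral_of_le hR.le,
    integral_rpow (Or.inl (by linarith)), sub_add_cancel, Real.zero_rpow hs.ne', sub_zero]

lemma IsSlowlyVarying.setLIntegral_powWeight_le {b : ℝ → ℝ} (hb : IsSlowlyVarying b) {α r : ℝ}
    (hα : 0 < α) (hr : 0 < r) :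
    ∃ C : ℝ, 0 < C ∧ ∀ R : ℝ, 0 < R →
      ∫⁻ t in Ioo (0 : ℝ) R, powWeight (α - r⁻¹) b t ^ r ≤
        ENNReal.ofReal (C * (R ^ α * b R) ^ r) := by
  obtain ⟨K, hK, h⟩ := hb.exists_potter (half_pos hα)
  have hs : 0 < α * r / 2 := by positivity
  refine ⟨K ^ r / (α * r / 2), by positivity, fun R hR => ?_⟩
  have hbR := hb.2.1 R hR
  calc ∫⁻ t in Ioo (0 : ℝ) R, powWeight (α - r⁻¹) b t ^ r
      ≤ ∫⁻ t in Ioo (0 : ℝ) R, ENNReal.ofReal ((K * R ^ (α / 2) * b R) ^ r) *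
          ENNReal.ofReal (t ^ (α * r / 2 - 1)) := by
        refine setLIntegral_mono' measurableSet_Ioo fun t ht => ?_
        have ht0 : 0 < t := ht.1
        have hbt := hb.2.1 t ht0
        unfold powWeight
        rw [ENNReal.ofReal_rpow_of_nonneg (by positivity) hr.le, ← ENNReal.ofReal_mul (by positivity)]
        refine ENNReal.ofReal_le_ofReal ?_
        calc (t ^ (α - r⁻¹) * b t) ^ r
            ≤ (t ^ (α - r⁻¹) * (K * (R / t) ^ (α / 2) * b R)) ^ r := by
              gcongr; exact (h t R ht0 ht.2.le).2
          _ = (K * R ^ (α / 2) * b R * t ^ (α / 2 - r⁻¹)) ^ r := by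
              rw [Real.div_rpow hR.le ht0.le, show α - r⁻¹ = α / 2 + (α / 2 - r⁻¹) by ring,
                Real.rpow_add ht0]
              have := Real.rpow_pos_of_pos ht0 (α / 2)
              congr 1
              field_simp
          _ = (K * R ^ (α / 2) * b R) ^ r * t ^ (α * r / 2 - 1) := by
              rw [Real.mul_rpow (by positivity) (by positivity), ← Real.rpow_mul ht0.le]
              congr 2
              field_simp
    _ = ENNReal.ofReal ((K * R ^ (α / 2) * b R) ^ r * (R ^ (α * r / 2) / (α * r / 2))) := by
        rw [lintegral_const_mul' _ _ ENNReal.ofReal_ne_top, setLIntegral_Ioo_rpow hs hR,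
          ← ENNReal.ofReal_mul (by positivity)]
    _ = ENNReal.ofReal (K ^ r / (α * r / 2) * (R ^ α * b R) ^ r) := by
        congr 1
        rw [show R ^ (α * r / 2) = (R ^ (α / 2)) ^ r by rw [← Real.rpow_mul hR.le]; congr 1; ring,
          show R ^ α = R ^ (α / 2) * R ^ (α / 2) by rw [← Real.rpow_add hR, add_halves],
          Real.mul_rpow (by positivity) (by positivity),
          Real.mul_rpow (by positivity) (by positivity),
          Real.mul_rpow (by positivity) (by positivity),
          Real.mul_rpow (by positivity) (by positivity)]
        ring

lemma IsSlowlyVarying.le_setLIntegral_Ioc {b : ℝ → ℝ} (hb : IsSlowlyVarying b) {α r : ℝ}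
    (hα : 1 ≤ α) (hr : 0 < r) :
    ∃ c : ℝ, 0 < c ∧ ∀ R : ℝ, 0 < R →
      ENNReal.ofReal (c * (R ^ (α - 1) * b R) ^ r) ≤
        ∫⁻ t in Ioc R (2 * R), (powWeight (α - r⁻¹) b t * (ENNReal.ofReal t)⁻¹) ^ r := by
  obtain ⟨D, hD, h⟩ := hb.exists_doubling
  refine ⟨1 / (2 * D ^ r), by positivity, fun R hR => ?_⟩
  have hbR := hb.2.1 R hR
  calc ENNReal.ofReal (1 / (2 * D ^ r) * (R ^ (α - 1) * b R) ^ r)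
      = ∫⁻ _ in Ioc R (2 * R), ENNReal.ofReal ((2 * R)⁻¹ * (R ^ (α - 1) * (b R / D)) ^ r) := by
        rw [setLIntegral_const, Real.volume_Ioc, ← ENNReal.ofReal_mul (by positivity)]
        congr 1
        rw [Real.mul_rpow (by positivity) (by positivity),
          Real.mul_rpow (by positivity) (by positivity), Real.div_rpow (by positivity) (by positivity)]
        have := Real.rpow_pos_of_pos hD r
        field_simp
        ring
    _ ≤ _ := by
        refine setLIntegral_mono' measurableSet_Ioc fun t ht => ?_
        have ht0 : 0 < t := hR.trans ht.1
        have hbt := hb.2.1 t ht0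
        unfold powWeight
        rw [← ENNReal.ofReal_inv_of_pos ht0, ← ENNReal.ofReal_mul (by positivity),
          ENNReal.ofReal_rpow_of_nonneg (by positivity) hr.le]
        refine ENNReal.ofReal_le_ofReal ?_
        calc (2 * R)⁻¹ * (R ^ (α - 1) * (b R / D)) ^ r ≤ t⁻¹ * (t ^ (α - 1) * b t) ^ r := by
              gcongr
              · exact ht.2
              · exact ht.1.le
              · rw [div_le_iff₀ hD, mul_comm]
                exact (h R t hR ht.1.le ht.2).2
          _ = (t ^ (α - r⁻¹) * b t * t⁻¹) ^ r := by
              have : t⁻¹ = (t ^ (-r⁻¹)) ^ r := by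
                rw [← Real.rpow_mul ht0.le, neg_mul, inv_mul_cancel₀ hr.ne', Real.rpow_neg_one]
              rw [this, ← Real.mul_rpow (by positivity) (by positivity), ← this,
                show α - r⁻¹ = -r⁻¹ + (α - 1) + 1 by ring, Real.rpow_add ht0, Real.rpow_add ht0,
                Real.rpow_one]
              congr 1
              field_simp

lemma IsSlowlyVarying.exists_large_tail {b : ℝ → ℝ} (hb : IsSlowlyVarying b) {α r : ℝ}
    (hα : 1 ≤ α) (hr : 0 < r) {L : ℝ} (hL : 0 < L) :
    ∃ n : ℕ, ENNReal.ofReal L * ∫⁻ t in Ioo (0 : ℝ) (2 ^ n), powWeight (α - r⁻¹) b t ^ r ≤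
      ENNReal.ofReal (2 ^ n) ^ r *
        ∫⁻ t in Ioi ((2 : ℝ) ^ n), (powWeight (α - r⁻¹) b t * (ENNReal.ofReal t)⁻¹) ^ r := by
  by_contra! hcon
  obtain ⟨C, hC, hV⟩ := hb.setLIntegral_powWeight_le (by linarith : 0 < α) hr
  obtain ⟨c, hc, hT⟩ := hb.le_setLIntegral_Ioc hα hr
  set H : ℕ → ℝ≥0∞ := fun n =>
    ∫⁻ t in Ioi ((2 : ℝ) ^ n), (powWeight (α - r⁻¹) b t * (ENNReal.ofReal t)⁻¹) ^ r with hH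
  let y : ℕ → ℝ := fun n => ((2 ^ n : ℝ) ^ (α - 1) * b (2 ^ n)) ^ r
  have hy : ∀ n, 0 < y n := fun n => by
    have := hb.2.1 (2 ^ n) (by simp)
    positivity
  have hup : ∀ n, H n ≤ ENNReal.ofReal (L * C * y n) := by
    intro n
    have h2 : (0 : ℝ) < 2 ^ n := by positivity
    have hb2 := hb.2.1 (2 ^ n) h2
    have h2r : ENNReal.ofReal (2 ^ n) ^ r ≠ 0 := by
      rw [ENNReal.ofReal_rpow_of_pos h2]
      simpa using Real.rpow_pos_of_pos h2 r
    have h2t : ENNReal.ofReal (2 ^ n) ^ r ≠ ∞ := by finiteness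
    rw [← ENNReal.mul_le_mul_iff_right h2r h2t]
    refine (hcon n).le.trans ((mul_le_mul_right (hV _ h2) _).trans_eq ?_)
    have := hy n
    rw [ENNReal.ofReal_rpow_of_pos h2, ← ENNReal.ofReal_mul hL.le,
      ← ENNReal.ofReal_mul (by positivity)]
    congr 1
    have : (2 ^ n : ℝ) ^ α = 2 ^ n * (2 ^ n) ^ (α - 1) := by
      nth_rw 2 [← Real.rpow_one ((2 : ℝ) ^ n)]
      rw [← Real.rpow_add h2, add_sub_cancel]
    simp only [y]
    rw [this, mul_assoc ((2 : ℝ) ^ n), Real.mul_rpow (by positivity) (by positivity)]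
    ring
  have hfin : ∀ n, H n ≠ ∞ := fun n => ne_top_of_le_ne_top ENNReal.ofReal_ne_top (hup n)
  have hstep : ∀ n, (H (n + 1)).toReal + c * y n ≤ (H n).toReal := by
    intro n
    have h2 : (0 : ℝ) < 2 ^ n := by positivity
    have hyn := hy n
    have hE : H (n + 1) + ENNReal.ofReal (c * y n) ≤ H n := by
      have hU : Ioi ((2 : ℝ) ^ n) = Ioc (2 ^ n) (2 * 2 ^ n) ∪ Ioi (2 ^ (n + 1)) := by
        rw [pow_succ', Ioc_union_Ioi_eq_Ioi (by linarith)]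
      have hsplit : H n = (∫⁻ t in Ioc ((2 : ℝ) ^ n) (2 * 2 ^ n),
          (powWeight (α - r⁻¹) b t * (ENNReal.ofReal t)⁻¹) ^ r) + H (n + 1) := by
        simp only [hH]
        rw [hU, lintegral_union measurableSet_Ioi]
        exact disjoint_left.2 fun x hx hx' => (hx.2.trans_eq (pow_succ' _ _).symm).not_gt hx'
      rw [hsplit, add_comm]
      gcongr
      exact hT _ h2
    have := ENNReal.toReal_mono (hfin _) hE
    rwa [ENNReal.toReal_add (hfin _) ENNReal.ofReal_ne_top, ENNReal.toReal_ofReal (by positivity)]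
      at this
  refine not_geometric_decay (H := fun n => (H n).toReal) (θ := 1 - c / (L * C))
    (by have : 0 < c / (L * C) := by positivity
        linarith) (fun n => ENNReal.toReal_nonneg) (fun n => ?_) ?_
  · have h1 : (H n).toReal ≤ L * C * y n := by
      have := hy n
      exact ENNReal.toReal_le_of_le_ofReal (by positivity) (hup n)
    have h2 : c / (L * C) * (H n).toReal ≤ c * y n := by
      calc c / (L * C) * (H n).toReal ≤ c / (L * C) * (L * C * y n) := by gcongr
        _ = c * y n := by field_simp
    linarith [hstep n]
  · intro ρ hρ0 hρ1
    obtain ⟨d, hd, hdle⟩ := hb.exists_mul_pow_le (Real.rpow_pos_of_pos hρ0 r⁻¹)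
      (Real.rpow_lt_one hρ0.le hρ1 (by positivity))
    refine ⟨c * d ^ r, by positivity, fun n => ?_⟩
    have h1 : d ^ r * ρ ^ n ≤ y n := by
      have h3 : d ^ r * ρ ^ n = (d * (ρ ^ r⁻¹) ^ n) ^ r := by
        rw [Real.mul_rpow hd.le (by positivity), ← Real.rpow_natCast (ρ ^ r⁻¹) n,
          ← Real.rpow_mul (by positivity), ← Real.rpow_mul hρ0.le,
          show r⁻¹ * (n * r) = n by field_simp, Real.rpow_natCast]
      have hb2 := hb.2.1 (2 ^ n) (by simp)
      rw [h3]
      refine Real.rpow_le_rpow (by positivity) ((hdle n).trans ?_) hr.le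
      exact le_mul_of_one_le_left hb2.le
        (Real.one_le_rpow (one_le_pow₀ (by norm_num)) (by linarith))
    have h4 : 0 ≤ (H (n + 1)).toReal := ENNReal.toReal_nonneg
    calc c * d ^ r * ρ ^ n = c * (d ^ r * ρ ^ n) := by ring
      _ ≤ c * y n := by gcongr
      _ ≤ (H n).toReal := by linarith [hstep n]

lemma exists_lkNorm_lt_top_of_ne_top (hna : IsNonatomic μ) (hμ : μ univ = ∞) {p q : ℝ≥0∞}
    (hα : 1 ≤ p⁻¹.toReal) (hq : 0 < q) (hqt : q ≠ ∞) {b : ℝ → ℝ} (hb : IsSlowlyVarying b) :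
    ∃ f : X → ℝ, Measurable f ∧ lkNorm μ p q b f < ∞ ∧ lkMaxNorm μ p q b f = ∞ := by
  have hr : 0 < q.toReal := ENNReal.toReal_pos hq.ne' hqt
  have hqinv : q⁻¹.toReal = q.toReal⁻¹ := ENNReal.toReal_inv q
  set α := p⁻¹.toReal with hαdef
  set r := q.toReal with hrdef
  set v := powWeight (α - r⁻¹) b with hv
  have hvm : Measurable v := hb.measurable_powWeight _
  choose m hm using fun k : ℕ => hb.exists_large_tail hα hr (L := 4 ^ k) (by positivity)
  obtain ⟨C, hC, hV⟩ := hb.setLIntegral_powWeight_le (by linarith : 0 < α) hr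
  let V : ℝ → ℝ≥0∞ := fun R => ∫⁻ t in Ioo (0 : ℝ) R, v t ^ r
  have hVt : ∀ n : ℕ, V (2 ^ n) ≠ ∞ := fun n =>
    ne_top_of_le_ne_top ENNReal.ofReal_ne_top (hV _ (by positivity))
  have hV1 : V 1 ≠ 0 := by
    have hpos : 0 < ∫⁻ t in Ioo (0 : ℝ) 1, v t ^ r := by
      rw [setLIntegral_pos_iff (hvm.pow_const r)]
      have : Ioo (0 : ℝ) 1 ⊆ Function.support (fun t => v t ^ r) ∩ Ioo 0 1 := by
        refine fun t ht => ⟨?_, ht⟩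
        have hvt : 0 < v t := by
          have h1 := hb.2.1 t ht.1
          have h2 := Real.rpow_pos_of_pos ht.1 (α - r⁻¹)
          exact ENNReal.ofReal_pos.2 (by positivity)
        exact (ENNReal.rpow_pos hvt ENNReal.ofReal_ne_top).ne'
      exact lt_of_lt_of_le (by simp) (measure_mono this)
    exact hpos.ne'
  have hVmono : ∀ n : ℕ, V 1 ≤ V (2 ^ n) := fun n =>
    lintegral_mono_set (Ioo_subset_Ioo_right (one_le_pow₀ (by norm_num)))
  have hV0 : ∀ n : ℕ, V (2 ^ n) ≠ 0 := fun n h => hV1 (le_zero_iff.1 (h ▸ hVmono n))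
  let A : ℕ → ℝ≥0∞ := fun k => ((2⁻¹) ^ k / V (2 ^ m k)) ^ r⁻¹
  have hAr : ∀ k, A k ^ r = (2⁻¹) ^ k / V (2 ^ m k) := fun k => by
    simp only [A]
    rw [← ENNReal.rpow_mul, inv_mul_cancel₀ hr.ne', ENNReal.rpow_one]
  have hAle : ∀ k, A k ≤ (1 / V 1) ^ r⁻¹ := fun k => by
    simp only [A]
    gcongr
    · exact pow_le_one₀ zero_le (by simp)
    · exact hVmono _
  let c : ℕ → ℝ≥0∞ := fun n => ⨆ k, if n < 2 ^ m k then A k else 0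
  have hc : Antitone c := fun n n' hn => by
    refine iSup_mono fun k => ?_
    by_cases h : n' < 2 ^ m k
    · simp [h, hn.trans_lt h]
    · simp [h]
  have hc0 : c 0 ≠ ∞ := by
    refine ne_top_of_le_ne_top (b := (1 / V 1) ^ r⁻¹) ?_ (iSup_le fun k => ?_)
    · exact ENNReal.rpow_ne_top_of_nonneg (by positivity) (by simp [hV1])
    · split_ifs
      · exact hAle k
      · exact zero_le
  obtain ⟨f, hfm, hf⟩ := hna.exists_rearr_eq hμ hc hc0
  have hfloor : ∀ (t : ℝ) (k : ℕ), 0 ≤ t → (⌊t⌋₊ < 2 ^ m k ↔ t < 2 ^ m k) := fun t k ht => by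
    rw [Nat.floor_lt ht]; push_cast; rfl
  refine ⟨f, hfm, ?_, ?_⟩
  · simp only [lkNorm, lqNorm, if_neg hqt, hqinv]
    refine ENNReal.rpow_lt_top_of_nonneg (by positivity) (ne_of_lt ?_)
    calc ∫⁻ t in Ioi (0 : ℝ), (v t * rearr μ f t) ^ r
        ≤ ∫⁻ t in Ioi (0 : ℝ), ∑' k,
            A k ^ r * (Ioo (0 : ℝ) (2 ^ m k)).indicator (fun t => v t ^ r) t := by
          refine setLIntegral_mono' measurableSet_Ioi fun t ht => ?_
          have ht0 : 0 < t := ht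
          rw [hf t ht0.le, ENNReal.mul_rpow_of_nonneg _ _ hr.le]
          refine (mul_le_mul_right (iSup_rpow_le_tsum hr _) _).trans ?_
          rw [← ENNReal.tsum_mul_left]
          refine ENNReal.tsum_le_tsum fun k => ?_
          by_cases h : t < 2 ^ m k
          · have hmem : t ∈ Ioo (0 : ℝ) (2 ^ m k) := ⟨ht0, h⟩
            rw [if_pos ((hfloor t k ht0.le).2 h), indicator_of_mem hmem, mul_comm]
          · rw [if_neg (fun h' => h ((hfloor t k ht0.le).1 h')), ENNReal.zero_rpow_of_pos hr, mul_zero]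
            exact zero_le
      _ = ∑' k, A k ^ r *
            ∫⁻ t in Ioi (0 : ℝ), (Ioo (0 : ℝ) (2 ^ m k)).indicator (fun t => v t ^ r) t := by
          rw [lintegral_tsum fun k =>
            (((hvm.pow_const r).indicator measurableSet_Ioo).const_mul _).aemeasurable]
          congr! 2 with k
          rw [lintegral_const_mul _ ((hvm.pow_const r).indicator measurableSet_Ioo)]
      _ ≤ ∑' k : ℕ, (2⁻¹) ^ k := by
          refine ENNReal.tsum_le_tsum fun k => ?_
          calc A k ^ r * ∫⁻ t in Ioi (0 : ℝ), (Ioo (0 : ℝ) (2 ^ m k)).indicator (fun t => v t ^ r) t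
              ≤ A k ^ r * V (2 ^ m k) := by
                gcongr
                refine (lintegral_mono' Measure.restrict_le_self le_rfl).trans_eq ?_
                rw [lintegral_indicator measurableSet_Ioo]
            _ = (2⁻¹) ^ k := by
                rw [hAr, ENNReal.div_mul_cancel (hV0 _) (hVt _)]
      _ < ∞ := (tsum_geometric_ne_top (by simp)).lt_top
  · simp only [lkMaxNorm, lqNorm, if_neg hqt, hqinv]
    refine (ENNReal.rpow_eq_top_iff_of_pos (by positivity)).2 ?_
    change ∫⁻ t in Ioi (0 : ℝ), (v t * maxf μ f t) ^ r = ∞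
    have hlow : ∀ k : ℕ, (2 : ℝ≥0∞) ^ k ≤ ∫⁻ t in Ioi (0 : ℝ), (v t * maxf μ f t) ^ r := by
      intro k
      have h2 : (0 : ℝ) < 2 ^ m k := by positivity
      have h4 : ENNReal.ofReal (4 ^ k) = 2 ^ k * 2 ^ k := by
        rw [← mul_pow, ENNReal.ofReal_pow (by norm_num)]; norm_num
      have hAt : A k ≠ ∞ := by
        refine ENNReal.rpow_ne_top_of_nonneg (by positivity) (ENNReal.div_ne_top (by finiteness) (hV0 _))
      have hG : ∀ t ∈ Ioi ((2 : ℝ) ^ m k), A k * ENNReal.ofReal (2 ^ m k) ≤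
          ∫⁻ s in Ioo (0 : ℝ) t, rearr μ f s := by
        intro t ht
        calc A k * ENNReal.ofReal (2 ^ m k) = ∫⁻ _ in Ioo (0 : ℝ) (2 ^ m k), A k := by
              rw [setLIntegral_const, Real.volume_Ioo, sub_zero]
          _ ≤ ∫⁻ s in Ioo (0 : ℝ) (2 ^ m k), rearr μ f s := by
              refine setLIntegral_mono' measurableSet_Ioo fun s hs => ?_
              rw [hf s hs.1.le]
              refine le_iSup_of_le k ?_
              rw [if_pos ((hfloor s k hs.1.le).2 hs.2)]
          _ ≤ _ := lintegral_mono_set (Ioo_subset_Ioo_right (mem_Ioi.1 ht).le)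
      calc (2 : ℝ≥0∞) ^ k = (2⁻¹) ^ k / V (2 ^ m k) * (ENNReal.ofReal (4 ^ k) * V (2 ^ m k)) := by
            rw [mul_left_comm, ENNReal.div_mul_cancel (hV0 _) (hVt _), h4, mul_assoc, ← mul_pow,
              ENNReal.mul_inv_cancel (by simp) (by simp), one_pow, mul_one]
        _ ≤ A k ^ r * (ENNReal.ofReal (2 ^ m k) ^ r *
              ∫⁻ t in Ioi ((2 : ℝ) ^ m k), (v t * (ENNReal.ofReal t)⁻¹) ^ r) := by
            rw [hAr]
            exact mul_le_mul_right (hm k) _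
        _ = ∫⁻ t in Ioi ((2 : ℝ) ^ m k),
              (A k * ENNReal.ofReal (2 ^ m k) * (v t * (ENNReal.ofReal t)⁻¹)) ^ r := by
            simp_rw [ENNReal.mul_rpow_of_nonneg (A k * _) _ hr.le]
            rw [lintegral_const_mul' _ _ (by finiteness), ENNReal.mul_rpow_of_nonneg _ _ hr.le, mul_assoc]
        _ ≤ ∫⁻ t in Ioi ((2 : ℝ) ^ m k), (v t * maxf μ f t) ^ r := by
            refine setLIntegral_mono' measurableSet_Ioi fun t ht => ?_
            rw [mul_comm (A k * _), mul_assoc]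
            unfold maxf
            gcongr
            exact hG t ht
        _ ≤ ∫⁻ t in Ioi (0 : ℝ), (v t * maxf μ f t) ^ r :=
            lintegral_mono_set (Ioi_subset_Ioi h2.le)
    have hlim : Tendsto (fun k : ℕ => (2 : ℝ≥0∞) ^ k) atTop (𝓝 ∞) :=
      ENNReal.tendsto_pow_atTop_nhds_top_iff.2 (by norm_num)
    exact top_le_iff.1 (le_of_tendsto' hlim hlow)

end Endpoint

/-- Corollary CEQNa: `L^{(p,q,b)} = L^{p,q,b}` if and only if `p > 1`. -/
theorem lk_eq_lkMax_iff {X : Type*} [MeasurableSpace X] (μ : Measure X)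
    [SigmaFinite μ] (hna : IsNonatomic μ) (hμ : μ Set.univ = ∞)
    (p q : ℝ≥0∞) (hp : 0 < p) (hq : 0 < q) (b : ℝ → ℝ) (hb : IsSlowlyVarying b) :
    {f : X → ℝ | Measurable f ∧ lkMaxNorm μ p q b f < ∞} =
      {f : X → ℝ | Measurable f ∧ lkNorm μ p q b f < ∞} ↔ 1 < p := by

  constructor
  · intro hset
    by_contra hp1
    have hα : 1 ≤ p⁻¹.toReal := by
      rw [← ENNReal.toReal_one]
      exact ENNReal.toReal_mono (ENNReal.inv_ne_top.2 hp.ne') (ENNReal.one_le_inv.2 (not_lt.1 hp1))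
    obtain ⟨f, hfm, hf, hfmax⟩ :
        ∃ f : X → ℝ, Measurable f ∧ lkNorm μ p q b f < ∞ ∧ lkMaxNorm μ p q b f = ∞ := by
      by_cases hqt : q = ∞
      · subst hqt
        exact exists_lkNorm_top_lt_top hna hμ hα hb
      · exact exists_lkNorm_lt_top_of_ne_top hna hμ hα hq hqt hb
    have hmem : f ∈ {f : X → ℝ | Measurable f ∧ lkMaxNorm μ p q b f < ∞} := by
      rw [hset]; exact ⟨hfm, hf⟩
    exact hmem.2.ne hfmax
  · intro hp1
    ext f
    exact and_congr_right fun _ =>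
      ⟨(lkNorm_le_lkMaxNorm μ p q b f).trans_lt, lkMaxNorm_lt_top hp1 hq hb⟩
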